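/- The local Bayer–Macrì decomposition in dimension two (Lemma 4.9(a)): let ch = (ch₀, ch₁, ch₂) with ch₀ ≠ 0, and let ω, β ∈ V satisfy Im Z_{ω,β}(ch) > 0; set μ := −Re Z_{ω,β}(ch)/Im Z_{ω,β}(ch) and α := β − (1/2)K. Then w_{ω,β}(ch) = Im Z_{ω,β}(ch) · ( μ·m(ω, ch) + m(β, ch) + w(ch) ) = Im Z_{ω,β}(ch) · ( μ·m(ω, ch) + m(α, ch) + u(ch) ), where m(L, ch) := (0, L, B(ch₁/ch₀ − (3/4)K, L)), w(ch) := (1, −(3/4)K, −ch₂/ch₀ − (1/2)χ + (11/32)B(K,K)) and u(ch) := w(ch) + m((1/2)K, ch). In particular (ch₁/ch₀)·(μω + β) − ch₂/ch₀ = β·(μω + β) − (1/2)(ω² + β²), where products denote the bilinear form B. -/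

import Mathlib

noncomputable section

variable {V : Type*} [AddCommGroup V] [Module ℝ V]

/-- The Mukai pairing on `ℝ × V × ℝ`. -/
def mukaiPair (B : V →ₗ[ℝ] V →ₗ[ℝ] ℝ) (K : V) (w v : ℝ × V × ℝ) : ℝ :=
  B w.2.1 v.2.1 - w.1 * (v.2.2 - (1/2) * B v.2.1 K)
    - v.1 * (w.2.2 + (1/2) * B w.2.1 K) - (1/8) * w.1 * v.1 * B K K

/-- The Mukai vector of a Chern character. -/
def mukaiVec (B : V →ₗ[ℝ] V →ₗ[ℝ] ℝ) (K : V) (χ : ℝ) (ch : ℝ × V × ℝ) : ℝ × V × ℝ :=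
  (ch.1, ch.2.1 - ((1/4 : ℝ) * ch.1) • K,
    ch.2.2 - (1/4) * B ch.2.1 K + (1/2) * ch.1 * (χ - (1/16) * B K K))

/-- Real part of the central charge `Z_{ω,β}(ch)`. -/
def ZRe (B : V →ₗ[ℝ] V →ₗ[ℝ] ℝ) (ω β : V) (ch : ℝ × V × ℝ) : ℝ :=
  -ch.2.2 + B ch.2.1 β - (ch.1 / 2) * (B β β - B ω ω)

/-- Imaginary part of the central charge `Z_{ω,β}(ch)`. -/
def ZIm (B : V →ₗ[ℝ] V →ₗ[ℝ] ℝ) (ω β : V) (ch : ℝ × V × ℝ) : ℝ :=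
  B ch.2.1 ω - ch.1 * B β ω

/-- Real part of the vector `℧_{Z_{ω,β}}`. -/
def mhoRe (B : V →ₗ[ℝ] V →ₗ[ℝ] ℝ) (K : V) (χ : ℝ) (ω β : V) : ℝ × V × ℝ :=
  (1, β - (3/4 : ℝ) • K,
    -(1/2) * B ω ω + (1/2) * B (β - (3/4 : ℝ) • K) (β - (3/4 : ℝ) • K)
      - (1/2) * (χ - (1/8) * B K K))

/-- Imaginary part of the vector `℧_{Z_{ω,β}}`. -/
def mhoIm (B : V →ₗ[ℝ] V →ₗ[ℝ] ℝ) (K : V) (ω β : V) : ℝ × V × ℝ :=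
  (0, ω, B (β - (3/4 : ℝ) • K) ω)

/-- The Bayer–Macrì vector `w_{ω,β}(ch)`. -/
def wBM (B : V →ₗ[ℝ] V →ₗ[ℝ] ℝ) (K : V) (χ : ℝ) (ω β : V) (ch : ℝ × V × ℝ) :
    ℝ × V × ℝ :=
  ZIm B ω β ch • mhoRe B K χ ω β - ZRe B ω β ch • mhoIm B K ω β

/-- The vector `m(L, ch)` for `ch₀ ≠ 0`. -/
def mVec (B : V →ₗ[ℝ] V →ₗ[ℝ] ℝ) (K : V) (ch : ℝ × V × ℝ) (L : V) : ℝ × V × ℝ :=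
  (0, L, B (ch.1⁻¹ • ch.2.1 - (3/4 : ℝ) • K) L)

/-- The vector `w(ch)` for `ch₀ ≠ 0`. -/
def wVec (B : V →ₗ[ℝ] V →ₗ[ℝ] ℝ) (K : V) (χ : ℝ) (ch : ℝ × V × ℝ) : ℝ × V × ℝ :=
  (1, -(3/4 : ℝ) • K, -(ch.2.2 / ch.1) - (1/2) * χ + (11/32) * B K K)

/-- The vector `u(ch) = w(ch) + m((1/2)K, ch)` for `ch₀ ≠ 0`. -/
def uVec (B : V →ₗ[ℝ] V →ₗ[ℝ] ℝ) (K : V) (χ : ℝ) (ch : ℝ × V × ℝ) : ℝ × V × ℝ :=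
  wVec B K χ ch + mVec B K ch ((1/2 : ℝ) • K)

/-- the local Bayer–Macrì decomposition in dimension two (Lemma 4.9(a)). -/
theorem local_BM_decomposition_dim_two
    (B : V →ₗ[ℝ] V →ₗ[ℝ] ℝ) (hB : ∀ v w : V, B v w = B w v)
    (K : V) (χ : ℝ) (ch : ℝ × V × ℝ) (hch₀ : ch.1 ≠ 0)
    (ω β : V) (hIm : 0 < ZIm B ω β ch)
    (μ : ℝ) (hμ : μ = -(ZRe B ω β ch) / ZIm B ω β ch) :
    wBM B K χ ω β ch
      = ZIm B ω β ch • (μ • mVec B K ch ω + mVec B K ch β + wVec B K χ ch) ∧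
    wBM B K χ ω β ch
      = ZIm B ω β ch •
          (μ • mVec B K ch ω + mVec B K ch (β - (1/2 : ℝ) • K) + uVec B K χ ch) ∧
    B (ch.1⁻¹ • ch.2.1) (μ • ω + β) - ch.2.2 / ch.1
      = B β (μ • ω + β) - (1/2) * (B ω ω + B β β) := by
  have h0 : ZRe B ω β ch = -(ZIm B ω β ch * μ) := by
    rw [hμ]
    field_simp [hIm.ne']
  have h3 : B (ch.1⁻¹ • ch.2.1) (μ • ω + β) - ch.2.2 / ch.1
      = B β (μ • ω + β) - (1/2) * (B ω ω + B β β) := by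
    have h := h0
    simp only [ZRe, ZIm] at h
    simp only [map_add, map_smul, LinearMap.smul_apply, smul_eq_mul]
    field_simp
    linarith
  have hw : wBM B K χ ω β ch
      = ZIm B ω β ch • (mhoRe B K χ ω β + μ • mhoIm B K ω β) := by
    rw [wBM, h0]
    module
  have hm : mhoRe B K χ ω β + μ • mhoIm B K ω β
      = μ • mVec B K ch ω + mVec B K ch β + wVec B K χ ch := by
    refine Prod.ext ?_ (Prod.ext ?_ ?_)
    · simp [mhoRe, mhoIm, mVec, wVec]
    · simp only [mhoRe, mhoIm, mVec, wVec, Prod.fst_add, Prod.snd_add, Prod.smul_fst,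
        Prod.smul_snd]
      module
    · have h := h3
      simp only [map_add, map_smul, LinearMap.smul_apply, smul_eq_mul] at h
      simp only [mhoRe, mhoIm, mVec, wVec, Prod.snd_add, Prod.smul_snd, map_sub, map_smul,
        LinearMap.sub_apply, LinearMap.smul_apply, smul_eq_mul]
      rw [hB β K]
      linarith
  have hu : mVec B K ch (β - (1/2 : ℝ) • K) + uVec B K χ ch
      = mVec B K ch β + wVec B K χ ch := by
    refine Prod.ext ?_ (Prod.ext ?_ ?_)
    · simp [mVec, uVec, wVec]
    · simp only [mVec, uVec, wVec, Prod.fst_add, Prod.snd_add]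
      module
    · simp only [mVec, uVec, wVec, Prod.snd_add, map_sub]
      ring
  refine ⟨by rw [hw, hm], ?_, h3⟩
  rw [hw, hm, add_assoc, add_assoc, hu]
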